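/- arXiv:math/0501078 — 4 statements merged into one kernel-verified Lean document; each statement's English description precedes it below -/
import Mathlib

section
/- Let A₂, …, A_p be q×q complex matrices. For k = 1, …, q define the q×p matrix M_k whose first column is the standard basis vector e_k of ℂ^q and whose j-th column (for 2 ≤ j ≤ p) is the k-th column of A_j. Then the span of {M₁, …, M_q} is an abelian subspace (i.e. ᵗM_kM_l = ᵗM_lM_k for all k, l) if and only if each A_j is symmetric and the A_j pairwise commute (A_iA_j = A_jA_i for all i, j). -/
open Matrix

/-- Given matrices `A j` (`j ≠ 0`), the `q×p` matrix `M k` whose first column is the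
standard basis vector `e_k` of `ℂ^q` and whose `j`-th column (`j ≠ 0`) is the `k`-th
column of `A j`.  (The matrix `A 0` is irrelevant.) -/
def distBasis {q p : ℕ} (hp : 0 < p) (A : Fin p → Matrix (Fin q) (Fin q) ℂ)
    (k : Fin q) : Matrix (Fin q) (Fin p) ℂ :=
  fun a b => if b = ⟨0, hp⟩ then (if a = k then 1 else 0) else A b a k

/-- The columns of `distBasis hp A k` are the `k`-th columns of the family `A` with `A 0`
replaced by the identity. -/
theorem distBasis_apply {q p : ℕ} (hp : 0 < p) (A : Fin p → Matrix (Fin q) (Fin q) ℂ)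
    (k a : Fin q) (b : Fin p) :
    distBasis hp A k a b = Function.update A ⟨0, hp⟩ 1 b a k := by
  by_cases hb : b = ⟨0, hp⟩
  · subst hb
    simp [distBasis, Matrix.one_apply]
  · simp [distBasis, hb]

theorem distBasis_abelian_iff {q p : ℕ} (hp : 0 < p)
    (A : Fin p → Matrix (Fin q) (Fin q) ℂ) :
    (∀ k l : Fin q,
        (distBasis hp A k)ᵀ * distBasis hp A l =
        (distBasis hp A l)ᵀ * distBasis hp A k) ↔
    ∀ i j : Fin p,
      (Function.update A ⟨0, hp⟩ 1 i)ᵀ * Function.update A ⟨0, hp⟩ 1 j =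
      (Function.update A ⟨0, hp⟩ 1 j)ᵀ * Function.update A ⟨0, hp⟩ 1 i := by
  have entry (k l : Fin q) (i j : Fin p) :
      ((distBasis hp A k)ᵀ * distBasis hp A l) i j =
      ((Function.update A ⟨0, hp⟩ 1 i)ᵀ * Function.update A ⟨0, hp⟩ 1 j) k l := by
    simp only [Matrix.mul_apply, Matrix.transpose_apply, distBasis_apply]
  have entry_swap (k l : Fin q) (i j : Fin p) :
      ((distBasis hp A l)ᵀ * distBasis hp A k) i j =
      ((Function.update A ⟨0, hp⟩ 1 j)ᵀ * Function.update A ⟨0, hp⟩ 1 i) k l := by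
    simp only [Matrix.mul_apply, Matrix.transpose_apply, distBasis_apply, mul_comm]
  constructor
  · intro h i j
    ext k l
    rw [← entry, ← entry_swap, h k l]
  · intro h k l
    ext i j
    rw [entry, entry_swap, h i j]

theorem stmt4 {q p : ℕ} (hp : 0 < p) (A : Fin p → Matrix (Fin q) (Fin q) ℂ) :
    (∀ k l : Fin q,
        (distBasis hp A k)ᵀ * distBasis hp A l =
        (distBasis hp A l)ᵀ * distBasis hp A k) ↔
    ((∀ j : Fin p, j ≠ ⟨0, hp⟩ → (A j)ᵀ = A j) ∧
     (∀ i j : Fin p, i ≠ ⟨0, hp⟩ → j ≠ ⟨0, hp⟩ → A i * A j = A j * A i)) := by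
  rw [distBasis_abelian_iff]
  constructor
  · intro h
    have symm (j : Fin p) (hj : j ≠ ⟨0, hp⟩) : (A j)ᵀ = A j := by
      simpa [hj] using h j ⟨0, hp⟩
    refine ⟨symm, fun i j hi hj => ?_⟩
    simpa [hi, hj, symm] using h i j
  · rintro ⟨symm, comm⟩ i j
    by_cases hi : i = ⟨0, hp⟩ <;> by_cases hj : j = ⟨0, hp⟩
    · rw [hi, hj]
    · simp [hi, hj, symm]
    · simp [hi, hj, symm]
    · simpa [hi, hj, symm] using comm i j hi hj
end

section
/- Let f and g be three times continuously differentiable functions on an open subset U of ℝ^q (or holomorphic on an open subset of ℂ^q), and define the vector field v on U by v_b(x) = Σ_{a=1}^q (∂f/∂x_a)(x) · (∂²g/∂x_a∂x_b)(x). Then for all x ∈ U and all indices b, c: (∂v_b/∂x_c)(x) − (∂v_c/∂x_b)(x) = [H_f(x), H_g(x)]_{cb}, the (c,b) entry of the commutator H_f(x)H_g(x) − H_g(x)H_f(x). Consequently the one-form Σ_a (∂f/∂x_a) d(∂g/∂x_a) is closed on U if and only if the Hessians H_f(x) and H_g(x) commute at every point x of U. -/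
open Matrix

/-- The partial derivative `∂f/∂x_a` of `f : ℝ^q → ℝ`. -/
noncomputable def pd {q : ℕ} (f : (Fin q → ℝ) → ℝ) (a : Fin q) (x : Fin q → ℝ) : ℝ :=
  fderiv ℝ f x (Pi.single a 1)

/-- The Hessian matrix of second partial derivatives of `f : ℝ^q → ℝ` at `x`. -/
noncomputable def Hess {q : ℕ} (f : (Fin q → ℝ) → ℝ) (x : Fin q → ℝ) :
    Matrix (Fin q) (Fin q) ℝ :=
  fun a b => pd (pd f a) b x

theorem ContDiffOn.pd {q : ℕ} {U : Set (Fin q → ℝ)} (hU : IsOpen U) {h : (Fin q → ℝ) → ℝ}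
    {m n : WithTop ℕ∞} (hh : ContDiffOn ℝ n h U) (hmn : m + 1 ≤ n) (a : Fin q) :
    ContDiffOn ℝ m (_root_.pd h a) U :=
  (hh.fderiv_of_isOpen hU hmn).clm_apply contDiffOn_const

/-- Symmetry of the second partial derivatives of a `C²` function. -/
theorem pd_pd_comm {q : ℕ} {h : (Fin q → ℝ) → ℝ} {x : Fin q → ℝ} (hh : ContDiffAt ℝ 2 h x)
    (a b : Fin q) : pd (pd h a) b x = pd (pd h b) a x := by
  have hd : DifferentiableAt ℝ (fderiv ℝ h) x :=
    (hh.fderiv_right (m := 1) (by norm_num)).differentiableAt (by norm_num)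
  have key (a b : Fin q) :
      pd (pd h a) b x = fderiv ℝ (fderiv ℝ h) x (Pi.single b 1) (Pi.single a 1) := by
    have := (hd.hasFDerivAt.clm_apply (hasFDerivAt_const (Pi.single a (1 : ℝ)) x)).fderiv
    refine (congrArg (fun L => L (Pi.single b 1)) this).trans ?_
    simp
  rw [key, key]
  exact (hh.isSymmSndFDerivAt (by simp)).eq _ _

/-- The product rule for the partial derivatives of a sum of products. -/
theorem pd_sum_mul {q : ℕ} {ι : Type*} (s : Finset ι) {u w : ι → (Fin q → ℝ) → ℝ}
    {x : Fin q → ℝ} (hu : ∀ i ∈ s, DifferentiableAt ℝ (u i) x)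
    (hw : ∀ i ∈ s, DifferentiableAt ℝ (w i) x) (c : Fin q) :
    pd (fun y => ∑ i ∈ s, u i y * w i y) c x =
      ∑ i ∈ s, (pd (u i) c x * w i x + u i x * pd (w i) c x) := by
  have := (HasFDerivAt.fun_sum fun i hi =>
    (hu i hi).hasFDerivAt.mul (hw i hi).hasFDerivAt).fderiv
  unfold pd
  rw [show (fun y => ∑ i ∈ s, u i y * w i y) = fun y => ∑ i ∈ s, (u i * w i) y from rfl, this]
  simp only [_root_.sum_apply, _root_.add_apply, _root_.smul_apply, smul_eq_mul]
  exact Finset.sum_congr rfl fun i _ => by ring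

theorem stmt7 {q : ℕ} (U : Set (Fin q → ℝ)) (hU : IsOpen U)
    (f g : (Fin q → ℝ) → ℝ)
    (hf : ContDiffOn ℝ 3 f U) (hg : ContDiffOn ℝ 3 g U)
    (v : Fin q → (Fin q → ℝ) → ℝ)
    (hv : ∀ b x, v b x = ∑ a, pd f a x * Hess g x a b) :
    (∀ x ∈ U, ∀ b c : Fin q,
        pd (v b) c x - pd (v c) b x =
          (Hess f x * Hess g x - Hess g x * Hess f x) c b) ∧
    ((∀ x ∈ U, ∀ b c : Fin q, pd (v b) c x = pd (v c) b x) ↔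
      (∀ x ∈ U, Hess f x * Hess g x = Hess g x * Hess f x)) := by
  have main : ∀ x ∈ U, ∀ b c : Fin q, pd (v b) c x - pd (v c) b x =
      (Hess f x * Hess g x - Hess g x * Hess f x) c b := by
    intro x hx b c
    have hxU := hU.mem_nhds hx
    have hf₁ (a) : ContDiffOn ℝ 2 (pd f a) U := hf.pd hU (by norm_num) a
    have hg₁ (a) : ContDiffOn ℝ 2 (pd g a) U := hg.pd hU (by norm_num) a
    have hg₂ (a b) : ContDiffOn ℝ 1 (pd (pd g a) b) U := (hg₁ a).pd hU (by norm_num) b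
    have hpd (b c) : pd (v b) c x =
        ∑ a, (pd (pd f a) c x * pd (pd g a) b x + pd f a x * pd (pd (pd g a) b) c x) := by
      rw [show v b = fun y => ∑ a, pd f a y * pd (pd g a) b y from funext (hv b)]
      exact pd_sum_mul _ (fun a _ => ((hf₁ a).contDiffAt hxU).differentiableAt (by norm_num))
        (fun a _ => ((hg₂ a b).contDiffAt hxU).differentiableAt (by norm_num)) c
    rw [hpd, hpd, Matrix.sub_apply, Matrix.mul_apply, Matrix.mul_apply,
      ← Finset.sum_sub_distrib, ← Finset.sum_sub_distrib]
    refine Finset.sum_congr rfl fun a _ => ?_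
    simp only [Hess]
    rw [pd_pd_comm ((hg₁ a).contDiffAt hxU) b c,
      pd_pd_comm ((hf.contDiffAt hxU).of_le (by norm_num)) c a,
      pd_pd_comm ((hg.contDiffAt hxU).of_le (by norm_num)) c a]
    ring
  refine ⟨main, fun h x hx => ?_, fun h x hx b c => ?_⟩
  · rw [← sub_eq_zero]
    ext c b
    rw [← main x hx b c, h x hx b c, sub_self, Matrix.zero_apply]
  · rw [← sub_eq_zero, main x hx b c, h x hx, sub_self, Matrix.zero_apply]
end

section
/- Let U be a star-shaped (e.g. convex) open subset of ℝ^q and let f, g : U → ℝ be three times continuously differentiable with [H_f(x), H_g(x)] = 0 for all x ∈ U. Then there exists a function Z : U → ℝ such that for every index b and every x ∈ U, (∂Z/∂x_b)(x) = Σ_{a=1}^q (∂f/∂x_a)(x) · (∂²g/∂x_a∂x_b)(x). -/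
open Matrix

/-- A closed `1`-form on an open star-convex set is exact. -/
theorem StarConvex.exists_forall_hasFDerivAt_of_hasFDerivAt_symmetric
    {E F : Type*} [NormedAddCommGroup E] [NormedSpace ℝ E] [NormedAddCommGroup F] [NormedSpace ℝ F]
    [CompleteSpace F] {s : Set E} {x₀ : E} {ω : E → E →L[ℝ] F} {dω : E → E →L[ℝ] E →L[ℝ] F}
    (hs : StarConvex ℝ x₀ s) (hso : IsOpen s) (hω : ∀ x ∈ s, HasFDerivAt ω (dω x) x)
    (hdω : ∀ x ∈ s, ∀ u v, dω x u v = dω x v u) :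
    ∃ f : E → F, ∀ x ∈ s, HasFDerivAt f (ω x) x := by
  refine ⟨fun y ↦ ∫ᶜ x in .segment x₀ y, ω x, fun b hb ↦ ?_⟩
  have hsource : HasFDerivAt (fun y ↦ ∫ᶜ x in .segment b y, ω x) (ω b) b :=
    .curveIntegral_segment_source' <| by
      filter_upwards [hso.mem_nhds hb] with z hz using (hω z hz).continuousAt
  refine (hsource.const_add (∫ᶜ x in .segment x₀ b, ω x)).congr_of_eventuallyEq ?_
  obtain ⟨ε, hε, hball⟩ := Metric.isOpen_iff.mp hso b hb
  filter_upwards [Metric.ball_mem_nhds b hε] with c hc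
  have htriangle : convexHull ℝ {x₀, b, c} ⊆ s := by
    rw [convexHull_insert (Set.insert_nonempty _ _), convexHull_pair]
    intro z hz
    obtain ⟨_, rfl, y, hy, hzy⟩ := mem_convexJoin.mp hz
    exact hs.segment_subset
      (hball ((convex_ball b ε).segment_subset (Metric.mem_ball_self hε) hc hy)) hzy
  exact ((convex_convexHull ℝ _).curveIntegral_segment_add_eq_of_hasFDerivWithinAt_symmetric
    (fun x hx ↦ (hω x (htriangle hx)).hasFDerivWithinAt)
    (fun x hx u _ v _ ↦ hdω x (htriangle hx) u v)
    (subset_convexHull ℝ _ (by simp)) (subset_convexHull ℝ _ (by simp))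
    (subset_convexHull ℝ _ (by simp))).symm

theorem contDiffOn_pd {q : ℕ} {U : Set (Fin q → ℝ)} (hU : IsOpen U) {f : (Fin q → ℝ) → ℝ}
    (hf : ContDiffOn ℝ 3 f U) (a : Fin q) : ContDiffOn ℝ 2 (pd f a) U :=
  (hf.fderiv_of_isOpen hU (by norm_num)).clm_apply contDiffOn_const

theorem Hess_mulVec {q : ℕ} (f : (Fin q → ℝ) → ℝ) (x u : Fin q → ℝ) (a : Fin q) :
    (Hess f x *ᵥ u) a = fderiv ℝ (pd f a) x u := by
  conv_rhs => rw [pi_eq_sum_univ' u, map_sum]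
  simp [mulVec, dotProduct, Hess, pd, mul_comm]

theorem Hess_isSymm {q : ℕ} {f : (Fin q → ℝ) → ℝ} {x : Fin q → ℝ} (hf : ContDiffAt ℝ 2 f x) :
    (Hess f x).IsSymm := by
  have hd : DifferentiableAt ℝ (fderiv ℝ f) x :=
    (hf.fderiv_right (m := 1) (by norm_num)).differentiableAt (by norm_num)
  have hHess (a b : Fin q) :
      Hess f x a b = fderiv ℝ (fderiv ℝ f) x (Pi.single b 1) (Pi.single a 1) := by
    unfold Hess
    rw [pd, show pd f a = fun y ↦ fderiv ℝ f y (Pi.single a 1) from rfl,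
      fderiv_clm_apply hd (by fun_prop)]
    simp
  ext a b
  rw [transpose_apply, hHess, hHess]
  exact hf.isSymmSndFDerivAt (by simp) _ _

/-- The product of two commuting symmetric matrices is symmetric, in terms of dot products. -/
theorem dotProduct_mulVec_comm_of_commute {n R : Type*} [Fintype n] [CommRing R]
    {A B : Matrix n n R} (hA : A.IsSymm) (hB : B.IsSymm) (hAB : A * B = B * A) (u v : n → R) :
    (A *ᵥ u) ⬝ᵥ (B *ᵥ v) = (A *ᵥ v) ⬝ᵥ (B *ᵥ u) := by
  have key {C D : Matrix n n R} (hC : C.IsSymm) :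
      (C *ᵥ u) ⬝ᵥ (D *ᵥ v) = u ⬝ᵥ ((C * D) *ᵥ v) := by
    rw [← mulVec_mulVec, dotProduct_mulVec u, ← mulVec_transpose, hC.eq]
  rw [key hA, hAB, ← key hB, dotProduct_comm]

theorem stmt8 {q : ℕ} (U : Set (Fin q → ℝ)) (hU : IsOpen U)
    (x₀ : Fin q → ℝ) (hx₀ : x₀ ∈ U) (hstar : StarConvex ℝ x₀ U)
    (f g : (Fin q → ℝ) → ℝ)
    (hf : ContDiffOn ℝ 3 f U) (hg : ContDiffOn ℝ 3 g U)
    (hcomm : ∀ x ∈ U, Hess f x * Hess g x - Hess g x * Hess f x = 0) :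
    ∃ Z : (Fin q → ℝ) → ℝ, ∀ x ∈ U, ∀ b : Fin q,
      pd Z b x = ∑ a, pd f a x * Hess g x a b := by
  have hfa (a : Fin q) : ContDiffOn ℝ 2 (pd f a) U := contDiffOn_pd hU hf a
  have hga (a : Fin q) : ContDiffOn ℝ 2 (pd g a) U := contDiffOn_pd hU hg a
  have hω : ∀ x ∈ U, HasFDerivAt (fun x ↦ ∑ a, pd f a x • fderiv ℝ (pd g a) x)
      (∑ a, (pd f a x • fderiv ℝ (fderiv ℝ (pd g a)) x +
        (fderiv ℝ (pd f a) x).smulRight (fderiv ℝ (pd g a) x))) x := by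
    intro x hx
    have hxU := hU.mem_nhds hx
    refine HasFDerivAt.fun_sum fun a _ ↦ ?_
    have hfd : HasFDerivAt (pd f a) (fderiv ℝ (pd f a) x) x :=
      (((hfa a).contDiffAt hxU).differentiableAt (by norm_num)).hasFDerivAt
    have hgd : HasFDerivAt (fderiv ℝ (pd g a)) (fderiv ℝ (fderiv ℝ (pd g a)) x) x :=
      ((((hga a).contDiffAt hxU).fderiv_right (m := 1) (by norm_num)).differentiableAt
        (by norm_num)).hasFDerivAt
    exact hfd.fun_smul hgd
  obtain ⟨Z, hZ⟩ := hstar.exists_forall_hasFDerivAt_of_hasFDerivAt_symmetric hU hω <| by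
    intro x hx u v
    have hxU := hU.mem_nhds hx
    have hsymm (a : Fin q) : fderiv ℝ (fderiv ℝ (pd g a)) x u v =
        fderiv ℝ (fderiv ℝ (pd g a)) x v u :=
      ((hga a).contDiffAt hxU).isSymmSndFDerivAt (by simp) u v
    have hquad := dotProduct_mulVec_comm_of_commute
      (Hess_isSymm ((hf.contDiffAt hxU).of_le (by norm_num)))
      (Hess_isSymm ((hg.contDiffAt hxU).of_le (by norm_num)))
      (sub_eq_zero.mp (hcomm x hx)) u v
    simp only [dotProduct, Hess_mulVec] at hquad
    simp [Finset.sum_add_distrib, hsymm, hquad]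
  refine ⟨Z, fun x hx b ↦ ?_⟩
  simp [pd, (hZ x hx).fderiv, Hess]
end

section
/- Let A₂, …, A_p be pairwise commuting symmetric q×q complex matrices, at least one of which has q distinct eigenvalues, and let C be a complex orthogonal matrix with C A_ℓ ᵗC = D_ℓ diagonal for every ℓ. For any tuple (h_{ℓj})_{ℓ=2..p, j=1..q} of entire functions h_{ℓj} : ℂ → ℂ satisfying h_{ℓj}(0) = h_{ℓj}'(0) = h_{ℓj}''(0) = 0, define f_ℓ(x) = (1/2) ᵗ(Cx) D_ℓ (Cx) + Σ_{j=1}^q h_{ℓj}((Cx)_j). Then: (1) [H_{f_ℓ}(x), H_{f_m}(x)] = 0 for all x ∈ ℂ^q and all ℓ, m; (2) H_{f_ℓ}(0) = A_ℓ for every ℓ; and (3) the map (h_{ℓj}) ↦ (f_ℓ) is injective. In particular, the set of solution tuples (f₂, …, f_p) of the system [H_{f_i}, H_{f_j}] = 0 with prescribed initial Hessians H_{f_ℓ}(0) = A_ℓ is infinite-dimensional. -/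
open Matrix

/-- The Hessian matrix of second partial derivatives of `f : ℂ^q → ℂ` at `x`. -/
noncomputable def HessC {q : ℕ} (f : (Fin q → ℂ) → ℂ) (x : Fin q → ℂ) :
    Matrix (Fin q) (Fin q) ℂ :=
  fun a b => fderiv ℂ (fun y => fderiv ℂ f y (Pi.single a 1)) x (Pi.single b 1)

/-- A tuple of one-variable functions is admissible if each is entire and vanishes
to second order at the origin: `h(0) = h'(0) = h''(0) = 0`. -/
def Admissible {q : ℕ} {ι : Type*} (h : ι → Fin q → ℂ → ℂ) : Prop :=
  ∀ ℓ j, Differentiable ℂ (h ℓ j) ∧ h ℓ j 0 = 0 ∧ deriv (h ℓ j) 0 = 0 ∧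
    deriv (deriv (h ℓ j)) 0 = 0

/-- The solution `f_ℓ(x) = (1/2) ᵗ(Cx) D_ℓ (Cx) + Σ_j h_{ℓj}((Cx)_j)` of the
commuting-Hessian system built from the diagonal data `d` and the tuple `h`. -/
noncomputable def Fsol {q : ℕ} {ι : Type*} (C : Matrix (Fin q) (Fin q) ℂ)
    (d : ι → Fin q → ℂ) (h : ι → Fin q → ℂ → ℂ) (ℓ : ι) (x : Fin q → ℂ) : ℂ :=
  (1 / 2) * ∑ j, d ℓ j * (C.mulVec x j) ^ 2 + ∑ j, h ℓ j (C.mulVec x j)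

/-- Partial derivative of a sum of one-variable functions of the coordinates of `C x`. -/
theorem fderiv_sum_comp_mulVec_single {q : ℕ} (C : Matrix (Fin q) (Fin q) ℂ)
    {g : Fin q → ℂ → ℂ} (hg : ∀ j, Differentiable ℂ (g j)) (x : Fin q → ℂ) (a : Fin q) :
    fderiv ℂ (fun y => ∑ j, g j (C.mulVec y j)) x (Pi.single a 1) =
      ∑ j, deriv (g j) (C.mulVec x j) * C j a := by
  have hlin (j : Fin q) : HasFDerivAt (fun y : Fin q → ℂ => C.mulVec y j)
      ((ContinuousLinearMap.proj (R := ℂ) (φ := fun _ : Fin q => ℂ) j).comp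
        (LinearMap.toContinuousLinearMap C.mulVecLin)) x :=
    ((ContinuousLinearMap.proj (R := ℂ) (φ := fun _ : Fin q => ℂ) j).comp
      (LinearMap.toContinuousLinearMap C.mulVecLin)).hasFDerivAt
  have hsum := HasFDerivAt.fun_sum (u := Finset.univ) fun j _ =>
    ((hg j) (C.mulVec x j)).hasDerivAt.comp_hasFDerivAt x (hlin j)
  rw [show (fun y => ∑ j, g j (C.mulVec y j)) =
    fun y => ∑ j, (g j ∘ fun y => C.mulVec y j) y from rfl, hsum.fderiv]
  simp

theorem hessC_sum_comp_mulVec {q : ℕ} (C : Matrix (Fin q) (Fin q) ℂ)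
    {g : Fin q → ℂ → ℂ} (hg : ∀ j, Differentiable ℂ (g j)) (x : Fin q → ℂ) :
    HessC (fun y => ∑ j, g j (C.mulVec y j)) x =
      Cᵀ * Matrix.diagonal (fun j => deriv (deriv (g j)) (C.mulVec x j)) * C := by
  ext a b
  have hg' (j : Fin q) : Differentiable ℂ (deriv (g j)) := (hg j).deriv
  simp only [HessC, fderiv_sum_comp_mulVec_single C hg]
  rw [fderiv_sum_comp_mulVec_single C (g := fun j t => deriv (g j) t * C j a)
    (fun j => (hg' j).mul_const _), Matrix.mul_apply]
  refine Finset.sum_congr rfl fun j _ => ?_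
  rw [deriv_mul_const (hg' j _), Matrix.mul_diagonal, Matrix.transpose_apply]
  ring

theorem hessC_Fsol {q : ℕ} {ι : Type*} (C : Matrix (Fin q) (Fin q) ℂ) (d : ι → Fin q → ℂ)
    {h : ι → Fin q → ℂ → ℂ} (hh : ∀ ℓ j, Differentiable ℂ (h ℓ j)) (ℓ : ι) (x : Fin q → ℂ) :
    HessC (Fsol C d h ℓ) x = Cᵀ * Matrix.diagonal
      (fun j => d ℓ j + deriv (deriv (h ℓ j)) (C.mulVec x j)) * C := by
  have hF : Fsol C d h ℓ = fun y => ∑ j,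
      (fun t => 1 / 2 * (d ℓ j * t ^ 2) + h ℓ j t) (C.mulVec y j) := by
    funext y
    simp only [Fsol, Finset.mul_sum, Finset.sum_add_distrib]
  have hderiv (j : Fin q) : deriv (fun t => 1 / 2 * (d ℓ j * t ^ 2) + h ℓ j t) =
      fun t => d ℓ j * t + deriv (h ℓ j) t := by
    funext t
    have := ((((hasDerivAt_id t).pow 2).const_mul (d ℓ j)).const_mul (1 / 2)).add
      (hh ℓ j t).hasDerivAt
    refine (this.congr_deriv ?_).deriv
    simp
    ring
  have hderiv₂ (j : Fin q) (t : ℂ) : deriv (fun t => d ℓ j * t + deriv (h ℓ j) t) t =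
      d ℓ j + deriv (deriv (h ℓ j)) t := by
    have := ((hasDerivAt_id t).const_mul (d ℓ j)).add ((hh ℓ j).deriv t).hasDerivAt
    exact (this.congr_deriv (by simp)).deriv
  rw [hF, hessC_sum_comp_mulVec C
    (g := fun j t => 1 / 2 * (d ℓ j * t ^ 2) + h ℓ j t) (fun j => by have := hh ℓ j; fun_prop)]
  simp only [hderiv, hderiv₂]

theorem transpose_mul_diagonal_mul_commute {q : ℕ} {C : Matrix (Fin q) (Fin q) ℂ}
    (hC : C * Cᵀ = 1) (u v : Fin q → ℂ) :
    Commute (Cᵀ * Matrix.diagonal u * C) (Cᵀ * Matrix.diagonal v * C) := by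
  have key (u v : Fin q → ℂ) : Cᵀ * Matrix.diagonal u * C * (Cᵀ * Matrix.diagonal v * C) =
      Cᵀ * Matrix.diagonal (fun j => u j * v j) * C := by
    rw [← Matrix.diagonal_mul_diagonal]
    calc _ = Cᵀ * Matrix.diagonal u * (C * Cᵀ) * Matrix.diagonal v * C := by noncomm_ring
      _ = _ := by rw [hC]; noncomm_ring
  rw [Commute, SemiconjBy, key, key]
  simp only [mul_comm]

/-- Evaluating along the `j`-th column of `Cᵀ` isolates the `j`-th one-variable function. -/
theorem Fsol_transpose_mulVec_single {q : ℕ} {ι : Type*} {C : Matrix (Fin q) (Fin q) ℂ}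
    (hC : C * Cᵀ = 1) (d : ι → Fin q → ℂ) {h : ι → Fin q → ℂ → ℂ}
    (hh : ∀ ℓ j, h ℓ j 0 = 0) (ℓ : ι) (j : Fin q) (t : ℂ) :
    Fsol C d h ℓ (Cᵀ.mulVec (Pi.single j t)) = 1 / 2 * (d ℓ j * t ^ 2) + h ℓ j t := by
  simp only [Fsol, Matrix.mulVec_mulVec, hC, Matrix.one_mulVec]
  rw [Fintype.sum_eq_single j, Fintype.sum_eq_single j]
  · simp
  · intro k hk
    simp [hk, hh]
  · intro k hk
    simp [hk]

theorem stmt14 {q : ℕ} {ι : Type*} (A : ι → Matrix (Fin q) (Fin q) ℂ)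
    (hsymm : ∀ ℓ, (A ℓ)ᵀ = A ℓ)
    (hcomm : ∀ ℓ m, A ℓ * A m = A m * A ℓ)
    (ℓ₀ : ι) (hdist : ((A ℓ₀).charpoly.roots).Nodup)
    (C : Matrix (Fin q) (Fin q) ℂ) (hC : Cᵀ * C = 1)
    (d : ι → Fin q → ℂ) (hd : ∀ ℓ, C * A ℓ * Cᵀ = Matrix.diagonal (d ℓ)) :
    -- (1) the Hessians of the f_ℓ commute everywhere
    (∀ h : ι → Fin q → ℂ → ℂ, Admissible h → ∀ ℓ m x,
      HessC (Fsol C d h ℓ) x * HessC (Fsol C d h m) x =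
      HessC (Fsol C d h m) x * HessC (Fsol C d h ℓ) x) ∧
    -- (2) the initial Hessians are the prescribed matrices A_ℓ
    (∀ h : ι → Fin q → ℂ → ℂ, Admissible h → ∀ ℓ,
      HessC (Fsol C d h ℓ) 0 = A ℓ) ∧
    -- (3) the map h ↦ (f_ℓ) is injective, so the solution set is
    -- infinite-dimensional
    (∀ h₁ h₂ : ι → Fin q → ℂ → ℂ, Admissible h₁ → Admissible h₂ →
      (∀ ℓ x, Fsol C d h₁ ℓ x = Fsol C d h₂ ℓ x) → h₁ = h₂) := by
  have hC' : C * Cᵀ = 1 := mul_eq_one_comm.mp hC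
  refine ⟨fun h hh ℓ m x => ?_, fun h hh ℓ => ?_, fun h₁ h₂ hh₁ hh₂ heq => ?_⟩
  · rw [hessC_Fsol C d (fun ℓ j => (hh ℓ j).1), hessC_Fsol C d (fun ℓ j => (hh ℓ j).1)]
    exact transpose_mul_diagonal_mul_commute hC' _ _
  · rw [hessC_Fsol C d (fun ℓ j => (hh ℓ j).1)]
    simp only [Matrix.mulVec_zero, Pi.zero_apply, (hh ℓ _).2.2.2, add_zero]
    rw [← hd ℓ]
    calc _ = (Cᵀ * C) * A ℓ * (Cᵀ * C) := by noncomm_ring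
      _ = A ℓ := by rw [hC, one_mul, mul_one]
  · funext ℓ j t
    have := heq ℓ (Cᵀ.mulVec (Pi.single j t))
    rwa [Fsol_transpose_mulVec_single hC' d (fun ℓ j => (hh₁ ℓ j).2.1),
      Fsol_transpose_mulVec_single hC' d (fun ℓ j => (hh₂ ℓ j).2.1), add_right_inj] at this
end
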